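/- If there is a constant C such that ∂₁²f + ∂₂²f = k(x³)² + C everywhere on ℝ⁴, then the Ricci curvature of the full connection of the generalised pp-wave with purely axial torsion satisfies Ric_{λν} = (C/2) l_λ l_ν, and it is parallel with respect to the full connection: ∂_μ Ric_{νλ} − Γ^η_{μν} Ric_{ηλ} − Γ^η_{μλ} Ric_{νη} = 0 for all μ, ν, λ. -/

import Mathlib

noncomputable section

open scoped BigOperators

/-- Points of spacetime: ℝ⁴ with coordinates x⁰, x¹, x², x³. -/
abbrev Spacetime := Fin 4 → ℝ

/-- Partial derivative ∂_μ of a scalar function. -/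
def pd (μ : Fin 4) (h : Spacetime → ℝ) : Spacetime → ℝ :=
  fun x => fderiv ℝ h x (Pi.single μ 1)

/-- The pp-metric g_{μν}: nonzero components g₀₃ = g₃₀ = 1, g₁₁ = g₂₂ = −1, g₃₃ = f. -/
def ppMetric (f : Spacetime → ℝ) (x : Spacetime) (μ ν : Fin 4) : ℝ :=
  if μ = 0 ∧ ν = 3 then 1 else if μ = 3 ∧ ν = 0 then 1
  else if μ = 1 ∧ ν = 1 then -1 else if μ = 2 ∧ ν = 2 then -1
  else if μ = 3 ∧ ν = 3 then f x else 0

/-- The pointwise inverse metric g^{μν}: g⁰⁰ = −f, g⁰³ = g³⁰ = 1, g¹¹ = g²² = −1. -/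
def ppMetricInv (f : Spacetime → ℝ) (x : Spacetime) (μ ν : Fin 4) : ℝ :=
  if μ = 0 ∧ ν = 0 then -(f x) else if μ = 0 ∧ ν = 3 then 1
  else if μ = 3 ∧ ν = 0 then 1
  else if μ = 1 ∧ ν = 1 then -1 else if μ = 2 ∧ ν = 2 then -1 else 0

/-- Christoffel symbols {Γ}^λ_{μν} = ½ g^{λκ}(∂_μ g_{κν} + ∂_ν g_{κμ} − ∂_κ g_{μν}). -/
def christoffel (f : Spacetime → ℝ) (x : Spacetime) (l μ ν : Fin 4) : ℝ :=
  (1/2) * ∑ κ, ppMetricInv f x l κ *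
    (pd μ (fun y => ppMetric f y κ ν) x + pd ν (fun y => ppMetric f y κ μ) x
      - pd κ (fun y => ppMetric f y μ ν) x)

/-- Totally antisymmetric symbol ε with ε₀₁₂₃ = 1. -/
def eps (a b c d : Fin 4) : ℝ :=
  ((((b:ℕ):ℝ) - ((a:ℕ):ℝ)) * (((c:ℕ):ℝ) - ((a:ℕ):ℝ)) * (((d:ℕ):ℝ) - ((a:ℕ):ℝ)) *
    (((c:ℕ):ℝ) - ((b:ℕ):ℝ)) * (((d:ℕ):ℝ) - ((b:ℕ):ℝ)) * (((d:ℕ):ℝ) - ((c:ℕ):ℝ))) / 12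

/-- Purely axial torsion T_{κμν} = k(x³) ε_{0κμν}. -/
def torsion (k : ℝ → ℝ) (x : Spacetime) (κ μ ν : Fin 4) : ℝ :=
  k (x 3) * eps 0 κ μ ν

/-- Contorsion K^κ_{μν} = ½ g^{κρ} T_{ρμν}. -/
def contorsion (f : Spacetime → ℝ) (k : ℝ → ℝ) (x : Spacetime) (κ μ ν : Fin 4) : ℝ :=
  (1/2) * ∑ ρ, ppMetricInv f x κ ρ * torsion k x ρ μ ν

/-- The full connection Γ^λ_{μν} = {Γ}^λ_{μν} + K^λ_{μν}. -/
def fullConn (f : Spacetime → ℝ) (k : ℝ → ℝ) (x : Spacetime) (κ μ ν : Fin 4) : ℝ :=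
  christoffel f x κ μ ν + contorsion f k x κ μ ν

/-- Curvature R[A]^κ_{λμν} of connection coefficients A^κ_{μν}. -/
def curv (A : Spacetime → Fin 4 → Fin 4 → Fin 4 → ℝ) (x : Spacetime)
    (κ l μ ν : Fin 4) : ℝ :=
  pd μ (fun y => A y κ ν l) x - pd ν (fun y => A y κ μ l) x
    + ∑ η, (A x κ μ η * A x η ν l - A x κ ν η * A x η μ l)

/-- The parallel null vector field l^μ = (1,0,0,0). -/
def lUp : Fin 4 → ℝ := fun μ => if μ = 0 then 1 else 0

/-- The lowered vector l_μ = g_{μν} l^ν = (0,0,0,1). -/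
def lCov : Fin 4 → ℝ := fun μ => if μ = 3 then 1 else 0

/-- Ricci curvature of the full connection: Ric_{λν} = R[Γ]^μ_{λμν}. -/
def RicFull (f : Spacetime → ℝ) (k : ℝ → ℝ) (x : Spacetime) (lam ν : Fin 4) : ℝ :=
  ∑ μ, curv (fullConn f k) x μ lam μ ν

lemma pd_const (μ : Fin 4) (c : ℝ) (x : Spacetime) : pd μ (fun _ => c) x = 0 := by
  simp [pd]

lemma pd_const_mul (μ : Fin 4) (c : ℝ) (h : Spacetime → ℝ) (x : Spacetime) :
    pd μ (fun y => c * h y) x = c * pd μ h x := by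
  have hd : fderiv ℝ (fun y => c * h y) x = c • fderiv ℝ h x :=
    congrFun (fderiv_const_smul_field c) x
  simp [pd, hd]

lemma pd_comp_coord_of_ne {k : ℝ → ℝ} (hk : Differentiable ℝ k) {μ i : Fin 4} (h : i ≠ μ)
    (x : Spacetime) : pd μ (fun y => k (y i)) x = 0 := by
  have hd : HasFDerivAt (fun y : Spacetime => k (y i))
      (deriv k (x i) • ContinuousLinearMap.proj (R := ℝ) (φ := fun _ : Fin 4 => ℝ) i) x :=
    (hk (x i)).hasDerivAt.comp_hasFDerivAt x (hasFDerivAt_apply i x)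
  simp [pd, hd.fderiv, h]

lemma pd_comm {f : Spacetime → ℝ} (hf : ContDiff ℝ 2 f) (μ ν : Fin 4) (x : Spacetime) :
    pd μ (pd ν f) x = pd ν (pd μ f) x := by
  have hd : DifferentiableAt ℝ (fderiv ℝ f) x :=
    ((hf.fderiv_right (m := 1) (by norm_num)).differentiable (by norm_num)) x
  have key (a b : Fin 4) :
      pd a (pd b f) x = fderiv ℝ (fderiv ℝ f) x (Pi.single a 1) (Pi.single b 1) := by
    change fderiv ℝ (fun y => fderiv ℝ f y (Pi.single b 1)) x (Pi.single a 1) = _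
    rw [fderiv_clm_apply hd (by fun_prop)]
    simp
  rw [key, key]
  exact (hf.contDiffAt.isSymmSndFDerivAt (by simp)) _ _

/-- The components of the full connection, as `4 × 4` matrices indexed by the upper index. -/
def ppConn (f : Spacetime → ℝ) (k : ℝ → ℝ) (x : Spacetime) : Fin 4 → Fin 4 → Fin 4 → ℝ :=
  ![![![0, 0, 0, 0],
      ![0, 0, 1/2 * k (x 3), 1/2 * pd 1 f x],
      ![0, -(1/2) * k (x 3), 0, 1/2 * pd 2 f x],
      ![0, 1/2 * pd 1 f x, 1/2 * pd 2 f x, 1/2 * pd 3 f x]],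
    ![![0, 0, 0, 0],
      ![0, 0, 0, 0],
      ![0, 0, 0, -(1/2) * k (x 3)],
      ![0, 0, 1/2 * k (x 3), 1/2 * pd 1 f x]],
    ![![0, 0, 0, 0],
      ![0, 0, 0, 1/2 * k (x 3)],
      ![0, 0, 0, 0],
      ![0, -(1/2) * k (x 3), 0, 1/2 * pd 2 f x]],
    ![![0, 0, 0, 0], ![0, 0, 0, 0], ![0, 0, 0, 0], ![0, 0, 0, 0]]]

lemma fullConn_eq_ppConn {f : Spacetime → ℝ} (h0 : ∀ x, pd 0 f x = 0) (k : ℝ → ℝ) :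
    fullConn f k = ppConn f k := by
  funext x κ μ ν
  fin_cases κ <;> fin_cases μ <;> fin_cases ν <;>
    simp [fullConn, christoffel, contorsion, torsion, ppMetricInv, ppMetric, eps, ppConn,
      Fin.sum_univ_four, pd_const, h0] <;> ring

lemma ricFull_eq {f : Spacetime → ℝ} (hf : ContDiff ℝ 2 f) (h0 : ∀ x, pd 0 f x = 0)
    {k : ℝ → ℝ} (hk : Differentiable ℝ k) (x : Spacetime) (l ν : Fin 4) :
    RicFull f k x l ν =
      (pd 1 (pd 1 f) x + pd 2 (pd 2 f) x - k (x 3) ^ 2) / 2 * lCov l * lCov ν := by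
  have hk0 := pd_comp_coord_of_ne hk (show (3 : Fin 4) ≠ 0 by decide) x
  have hk1 := pd_comp_coord_of_ne hk (show (3 : Fin 4) ≠ 1 by decide) x
  have hk2 := pd_comp_coord_of_ne hk (show (3 : Fin 4) ≠ 2 by decide) x
  have h0f (i : Fin 4) : pd 0 (fun y => pd i f y) x = 0 := by
    change pd 0 (pd i f) x = 0
    rw [pd_comm hf, funext h0, pd_const]
  have e1 : (fun y => pd 1 f y) = pd 1 f := rfl
  have e2 : (fun y => pd 2 f y) = pd 2 f := rfl
  rw [RicFull, fullConn_eq_ppConn h0]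
  fin_cases l <;> fin_cases ν <;>
    simp [curv, ppConn, lCov, Fin.sum_univ_four, pd_const, pd_const_mul, hk0, hk1, hk2, h0f,
      -one_div, -neg_mul]
  simp only [e1, e2]
  ring

/-- if ∂₁²f + ∂₂²f = k(x³)² + C then Ric = (C/2) l ⊗ l and Ric is
parallel with respect to the full connection. -/
theorem full_ricci_parallel_of_poisson_with_constant
    (f : Spacetime → ℝ) (hf : ContDiff ℝ (⊤ : ℕ∞) f) (h0 : ∀ x, pd 0 f x = 0)
    (k : ℝ → ℝ) (hk : ContDiff ℝ (⊤ : ℕ∞) k)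
    (C : ℝ) (hC : ∀ x : Spacetime, pd 1 (pd 1 f) x + pd 2 (pd 2 f) x = (k (x 3))^2 + C) :
    (∀ (x : Spacetime) (lam ν : Fin 4),
      RicFull f k x lam ν = (C/2) * lCov lam * lCov ν) ∧
    (∀ (x : Spacetime) (μ ν lam : Fin 4),
      pd μ (fun y => RicFull f k y ν lam) x
        - ∑ η, fullConn f k x η μ ν * RicFull f k x η lam
        - ∑ η, fullConn f k x η μ lam * RicFull f k x ν η = 0) := by
  have hRic (x : Spacetime) (lam ν : Fin 4) :
      RicFull f k x lam ν = (C/2) * lCov lam * lCov ν := by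
    rw [ricFull_eq (contDiff_infty.1 hf 2) h0 (hk.differentiable (by simp)), hC]
    ring
  refine ⟨hRic, fun x μ ν lam => ?_⟩
  have hΓ (μ ν : Fin 4) : fullConn f k x 3 μ ν = 0 := by
    rw [fullConn_eq_ppConn h0]
    fin_cases μ <;> fin_cases ν <;> rfl
  simp [hRic, pd_const, lCov, hΓ]
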